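/- arXiv:1811.09804 — 13 statements merged into one kernel-verified Lean document; each statement's English description precedes it below -/
import Mathlib

section
/- Let m > 1 be a natural number and n ≥ 1 with n − m + 2 ≥ 1. Let p₁,…,pₙ ∈ (0,1) satisfy pᵢ = 1/m for every index i with n − m + 2 ≤ i ≤ n. Then the optimal threshold equals s = n − m + 2 (that is, R_{n−m+2} ≥ 1 and R_k < 1 for every k > n − m + 2), and the optimal win probability satisfies V(p₁,…,pₙ) = ((m−1)/m)^{m−1} > 1/e. -/
open Finset

/-- Tail sum of odds `R_k = ∑_{i=k}^n pᵢ/(1-pᵢ)`. -/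
noncomputable def oddsSum (p : ℕ → ℝ) (n k : ℕ) : ℝ := ∑ i ∈ Finset.Icc k n, p i / (1 - p i)

/-- Tail product of failure probabilities `Q_k = ∏_{i=k}^n (1-pᵢ)`. -/
noncomputable def failProd (p : ℕ → ℝ) (n k : ℕ) : ℝ := ∏ i ∈ Finset.Icc k n, (1 - p i)

/-- `s` is the optimal threshold of Bruss's odds theorem:
`s = max {1 ≤ k ≤ n : R_k ≥ 1}` if `R_1 ≥ 1`, and `s = 1` otherwise. -/
def IsOptimalThreshold (p : ℕ → ℝ) (n s : ℕ) : Prop :=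
  if 1 ≤ oddsSum p n 1 then
    s ∈ Finset.Icc 1 n ∧ 1 ≤ oddsSum p n s ∧
      ∀ k ∈ Finset.Icc 1 n, s < k → oddsSum p n k < 1
  else s = 1

theorem stmt_2 (m n : ℕ) (p : ℕ → ℝ)
    (hm : 1 < m) (hn : 1 ≤ n) (hmn : m ≤ n + 1)
    (hp : ∀ i ∈ Finset.Icc 1 n, 0 < p i ∧ p i < 1)
    (hpm : ∀ i ∈ Finset.Icc (n + 2 - m) n, p i = 1 / (m : ℝ)) :
    IsOptimalThreshold p n (n + 2 - m) ∧
    failProd p n (n + 2 - m) * oddsSum p n (n + 2 - m)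
      = (((m : ℝ) - 1) / m) ^ (m - 1) ∧
    (((m : ℝ) - 1) / m) ^ (m - 1) > 1 / Real.exp 1 := by
  obtain ⟨M, rfl⟩ : ∃ M, m = M + 1 := ⟨m - 1, by omega⟩
  have hM : (0 : ℝ) < M := by
    have : 0 < M := by omega
    exact_mod_cast this
  have hM1 : (0 : ℝ) < (M : ℝ) + 1 := by linarith
  have hR : ∀ k, n + 2 - (M + 1) ≤ k →
      oddsSum p n k = ((n + 1 - k : ℕ) : ℝ) * (1 / (M : ℝ)) := by
    intro k hk
    unfold oddsSum
    rw [Finset.sum_congr rfl (g := fun _ => 1 / (M : ℝ))]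
    · rw [Finset.sum_const, Nat.card_Icc, nsmul_eq_mul]
    · intro i hi
      rw [Finset.mem_Icc] at hi
      rw [hpm i (Finset.mem_Icc.mpr ⟨by omega, hi.2⟩)]
      push_cast
      have : (1 : ℝ) - 1 / ((M : ℝ) + 1) = M / (M + 1) := by field_simp; ring
      rw [this]
      field_simp
  have hRs : oddsSum p n (n + 2 - (M + 1)) = 1 := by
    rw [hR _ le_rfl, show n + 1 - (n + 2 - (M + 1)) = M by omega]
    field_simp
  have hQ : failProd p n (n + 2 - (M + 1)) = ((M : ℝ) / (M + 1)) ^ M := by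
    unfold failProd
    rw [Finset.prod_congr rfl (g := fun _ => (M : ℝ) / (M + 1))]
    · rw [Finset.prod_const, Nat.card_Icc, show n + 1 - (n + 2 - (M + 1)) = M by omega]
    · intro i hi
      rw [hpm i hi]
      push_cast
      field_simp
      ring
  have hR1 : 1 ≤ oddsSum p n 1 := by
    rw [← hRs]
    unfold oddsSum
    apply Finset.sum_le_sum_of_subset_of_nonneg
    · exact Finset.Icc_subset_Icc (by omega) le_rfl
    · intro i hi _
      have := hp i hi
      exact div_nonneg this.1.le (by linarith [this.2])
  refine ⟨?_, ?_, ?_⟩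
  · unfold IsOptimalThreshold
    rw [if_pos hR1]
    refine ⟨Finset.mem_Icc.mpr ⟨by omega, by omega⟩, hRs.ge, ?_⟩
    intro k hk hlt
    rw [Finset.mem_Icc] at hk
    rw [hR k hlt.le, mul_one_div, div_lt_one hM]
    exact_mod_cast (by omega : n + 1 - k < M)
  · rw [hRs, hQ]
    push_cast
    simp
  · push_cast
    simp only [add_sub_cancel_right, Nat.add_sub_cancel]
    have h1 : 1 / (M : ℝ) + 1 < Real.exp (1 / M) :=
      Real.add_one_lt_exp (by positivity)
    have h2 : (1 / (M : ℝ) + 1) ^ M < Real.exp 1 := by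
      calc (1 / (M : ℝ) + 1) ^ M < Real.exp (1 / M) ^ M :=
            pow_lt_pow_left₀ h1 (by positivity) (by omega)
        _ = Real.exp 1 := by
            rw [← Real.exp_nat_mul, mul_one_div_cancel hM.ne']
    have h3 : ((M : ℝ) / (M + 1)) ^ M = 1 / (1 / (M : ℝ) + 1) ^ M := by
      rw [← one_div_pow]
      congr 1
      field_simp
      try ring
    rw [h3]
    exact one_div_lt_one_div_of_lt (by positivity) h2
end

section
/- Let p₁,…,pₙ ∈ (0,1) with R₁ ≥ 1, let s be the optimal threshold and V(p₁,…,pₙ) the optimal win probability. Let 𝐩 ∈ (0,1) satisfy 𝐩 ≤ pᵢ for every i with s ≤ i ≤ n, and set p_{n+1} = 1/⌈1/𝐩⌉ (so p_{n+1} ≤ 𝐩). Then the optimal win probability of the extended sequence does not exceed the original one: V(p₁,…,pₙ,p_{n+1}) ≤ V(p₁,…,pₙ). -/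
open Finset

theorem stmt_3 (n s s' : ℕ) (p q : ℕ → ℝ) (b : ℝ)
    (hn : 1 ≤ n)
    (hp : ∀ i ∈ Finset.Icc 1 n, 0 < p i ∧ p i < 1)
    (hR1 : 1 ≤ oddsSum p n 1)
    (hs : IsOptimalThreshold p n s)
    (hb0 : 0 < b) (hb1 : b < 1)
    (hble : ∀ i ∈ Finset.Icc s n, b ≤ p i)
    (hq : ∀ i ∈ Finset.Icc 1 n, q i = p i)
    (hqn : q (n + 1) = 1 / (⌈1 / b⌉₊ : ℝ))
    (hs' : IsOptimalThreshold q (n + 1) s') :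
    failProd q (n + 1) s' * oddsSum q (n + 1) s'
      ≤ failProd p n s * oddsSum p n s := by
  have hm : 1 / b ≤ (⌈1 / b⌉₊ : ℝ) := Nat.le_ceil _
  have h1b : 1 < 1 / b := by rw [lt_div_iff₀ hb0]; linarith
  have hm0 : (0 : ℝ) < (⌈1 / b⌉₊ : ℝ) := by linarith
  obtain ⟨c, hc⟩ : ∃ c, c = q (n + 1) := ⟨_, rfl⟩
  have hc0 : 0 < c := by rw [hc, hqn]; positivity
  have hcb : c ≤ b := by
    rw [hc, hqn, div_le_iff₀ hm0]
    rw [div_le_iff₀ hb0] at hm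
    linarith
  have hc1 : 0 < 1 - c := by linarith
  have hodd : ∀ k, 1 ≤ k → k ≤ n + 1 → oddsSum q (n + 1) k = oddsSum p n k + c / (1 - c) := by
    intro k hk hk'
    unfold oddsSum
    rw [Finset.sum_Icc_succ_top hk', ← hc]
    congr 1
    apply Finset.sum_congr rfl
    intro i hi
    rw [Finset.mem_Icc] at hi
    rw [hq i (by rw [Finset.mem_Icc]; omega)]
  have hfail : ∀ k, 1 ≤ k → k ≤ n + 1 → failProd q (n + 1) k = failProd p n k * (1 - c) := by
    intro k hk hk'
    unfold failProd
    rw [Finset.prod_Icc_succ_top hk', ← hc]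
    congr 1
    apply Finset.prod_congr rfl
    intro i hi
    rw [Finset.mem_Icc] at hi
    rw [hq i (by rw [Finset.mem_Icc]; omega)]
  have hostep : ∀ k, k ≤ n → oddsSum p n k = p k / (1 - p k) + oddsSum p n (k + 1) := by
    intro k hk
    unfold oddsSum
    rw [← Finset.insert_Icc_add_one_left_eq_Icc hk, Finset.sum_insert (by simp)]
  have hfstep : ∀ k, k ≤ n → failProd p n k = (1 - p k) * failProd p n (k + 1) := by
    intro k hk
    unfold failProd
    rw [← Finset.insert_Icc_add_one_left_eq_Icc hk, Finset.prod_insert (by simp)]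
  have hfpos : ∀ k, 1 ≤ k → 0 ≤ failProd p n k := by
    intro k hk
    apply Finset.prod_nonneg
    intro i hi
    rw [Finset.mem_Icc] at hi
    have := hp i (by rw [Finset.mem_Icc]; omega)
    linarith
  have hcp : 0 < c / (1 - c) := by positivity
  unfold IsOptimalThreshold at hs hs'
  rw [if_pos hR1] at hs
  rw [if_pos (by rw [hodd 1 le_rfl (by omega)]; linarith)] at hs'
  obtain ⟨hsm, hs1, hs2⟩ := hs
  obtain ⟨hsm', -, hs2'⟩ := hs'
  rw [Finset.mem_Icc] at hsm hsm'
  have hle : s ≤ s' := by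
    by_contra h
    have := hs2' s (by rw [Finset.mem_Icc]; omega) (by omega)
    rw [hodd s (by omega) (by omega)] at this
    linarith
  have hlt : ∀ k, s < k → k ≤ n + 1 → oddsSum p n k ≤ 1 := by
    intro k hk hk'
    by_cases h : k ≤ n
    · exact (hs2 k (by rw [Finset.mem_Icc]; omega) hk).le
    · unfold oddsSum
      rw [Finset.Icc_eq_empty (by omega)]
      simp
  have hW : ∀ k, 1 ≤ k → k ≤ n → failProd p n k * oddsSum p n k =
      failProd p n (k + 1) * (oddsSum p n (k + 1) * (1 - p k) + p k) := by
    intro k hk hk'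
    have := (hp k (by rw [Finset.mem_Icc]; omega)).2
    have h2 : 1 - p k ≠ 0 := by linarith
    rw [hostep k hk', hfstep k hk']
    field_simp
    ring
  have hchain : ∀ k, s ≤ k → k ≤ n →
      failProd p n k * oddsSum p n k ≤ failProd p n s * oddsSum p n s := by
    intro k hk
    induction k, hk using Nat.le_induction with
    | base => intro _; exact le_rfl
    | succ k hk ih =>
      intro hkn
      refine le_trans ?_ (ih (by omega))
      rw [hW k (by omega) (by omega)]
      apply mul_le_mul_of_nonneg_left _ (hfpos _ (by omega))
      have h1 := hlt (k + 1) (by omega) (by omega)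
      have h2 := (hp k (by rw [Finset.mem_Icc]; omega)).1
      nlinarith
  have hnew : failProd q (n + 1) s' * oddsSum q (n + 1) s' =
      failProd p n s' * (oddsSum p n s' * (1 - c) + c) := by
    rw [hodd s' (by omega) (by omega), hfail s' (by omega) (by omega)]
    field_simp
  rw [hnew]
  rcases Nat.eq_or_lt_of_le hle with h | h
  · subst h
    apply mul_le_mul_of_nonneg_left _ (hfpos _ (by omega))
    nlinarith
  · obtain ⟨k, rfl⟩ : ∃ k, s' = k + 1 := ⟨s' - 1, by omega⟩
    refine le_trans ?_ (hchain k (by omega) (by omega))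
    rw [hW k (by omega) (by omega)]
    apply mul_le_mul_of_nonneg_left _ (hfpos _ (by omega))
    have h1 := hlt (k + 1) (by omega) (by omega)
    have h2 := hble k (by rw [Finset.mem_Icc]; omega)
    nlinarith
end

section
/- Let m ≥ 1 be a natural number and let x₁,…,x_m ∈ (0,1) be real numbers such that R := ∑_{i=1}^{m} xᵢ/(1−xᵢ) < 1. Then ∏_{i=1}^{m} (1−xᵢ) ≥ (m/(m+R))^m > e^{−R} > 1/e. -/
theorem stmt_4 (m : ℕ) (x : ℕ → ℝ) (R : ℝ)
    (hm : 1 ≤ m)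
    (hx : ∀ i ∈ Finset.Icc 1 m, 0 < x i ∧ x i < 1)
    (hR : R = ∑ i ∈ Finset.Icc 1 m, x i / (1 - x i))
    (hR1 : R < 1) :
    (∏ i ∈ Finset.Icc 1 m, (1 - x i)) ≥ ((m : ℝ) / (m + R)) ^ m ∧
    ((m : ℝ) / (m + R)) ^ m > Real.exp (-R) ∧
    Real.exp (-R) > 1 / Real.exp 1 := by
  have hm0 : (0 : ℝ) < m := by exact_mod_cast hm
  have hRpos : 0 < R := by
    rw [hR]
    apply Finset.sum_pos
    · intro i hi
      obtain ⟨h0, h1⟩ := hx i hi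
      exact div_pos h0 (by linarith)
    · exact ⟨1, Finset.mem_Icc.mpr ⟨le_refl _, hm⟩⟩
  have hmR : 0 < (m : ℝ) + R := by linarith
  refine ⟨?_, ?_, ?_⟩
  · have key : ∏ i ∈ Finset.Icc 1 m, Real.exp (1 - (m / (m + R)) * (1 + x i / (1 - x i)))
        ≤ ∏ i ∈ Finset.Icc 1 m, ((1 - x i) * ((m + R) / m)) := by
      apply Finset.prod_le_prod
      · intro i _
        exact (Real.exp_pos _).le
      · intro i hi
        obtain ⟨h0, h1⟩ := hx i hi
        have hy : 0 < 1 - x i := by linarith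
        have hz : 0 < (1 - x i) * ((m + R) / m) := by positivity
        have e : (m / (m + R)) * (1 + x i / (1 - x i)) = ((1 - x i) * ((m + R) / m))⁻¹ := by
          field_simp
          ring
        rw [e, ← Real.le_log_iff_exp_le hz]
        exact Real.one_sub_inv_le_log_of_pos hz
    rw [← Real.exp_sum, Finset.sum_sub_distrib, ← Finset.mul_sum, Finset.sum_add_distrib,
      ← hR, Finset.prod_mul_distrib] at key
    simp only [Finset.sum_const, Finset.prod_const, Nat.card_Icc, Nat.add_sub_cancel,
      nsmul_eq_mul, mul_one] at key
    rw [div_mul_cancel₀ _ hmR.ne', sub_self, Real.exp_zero] at key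
    have hp : 0 < ((m : ℝ) / (m + R)) ^ m := by positivity
    have h2 : (((m : ℝ) + R) / m) ^ m * ((m : ℝ) / (m + R)) ^ m = 1 := by
      rw [← mul_pow, div_mul_div_cancel₀ hm0.ne', div_self hmR.ne', one_pow]
    have := mul_le_mul_of_nonneg_right key hp.le
    rw [mul_assoc, h2] at this
    linarith
  · have h1 : R / m + 1 < Real.exp (R / m) := Real.add_one_lt_exp (by positivity)
    have h2 : Real.exp (-R) = (Real.exp (-(R / m))) ^ m := by
      rw [← Real.exp_nat_mul]
      congr 1
      field_simp
    rw [h2]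
    apply pow_lt_pow_left₀ _ (Real.exp_pos _).le (by omega)
    have e : (m : ℝ) / (m + R) = (R / m + 1)⁻¹ := by
      field_simp
      ring
    rw [e, Real.exp_neg]
    exact inv_strictAnti₀ (by positivity) h1
  · rw [one_div, ← Real.exp_neg]
    exact Real.exp_lt_exp.mpr (by linarith)
end

section
/- Let p₁,…,pₙ ∈ (0,1) with R₁ ≥ 1, let s be the optimal threshold, and let 𝔭 := min{pᵢ : s ≤ i ≤ n}. Then the optimal win probability satisfies V(p₁,…,pₙ) ≥ (1 − 1/⌈1/𝔭⌉)^{⌈1/𝔭⌉ − 1} > 1/e. -/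
open Finset

lemma aux_prod (T : Finset ℕ) (r : ℕ → ℝ) (hr : ∀ i ∈ T, 0 ≤ r i) (A : ℝ)
    (hA : A = ∑ i ∈ T, r i) (hA1 : A < 1) (M : ℕ) (hM : #T + 1 ≤ M) :
    (2 - A) * ∏ i ∈ T, (1 + r i) ≤ (1 + 1 / (M : ℝ)) ^ M := by
  have hMpos : (0 : ℝ) < M := by exact_mod_cast (by omega : 0 < M)
  set c : ℝ := 1 + 1 / (M : ℝ) with hc
  have hcpos : 0 < c := by positivity
  have hcM : (M : ℝ) * c = M + 1 := by rw [hc]; field_simp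
  have key : ∀ y : ℝ, 0 < y → Real.log y ≤ Real.log c + (y - c) / c := by
    intro y hy
    have h := Real.log_le_sub_one_of_pos (div_pos hy hcpos)
    rw [Real.log_div hy.ne' hcpos.ne'] at h
    have : (y - c) / c = y / c - 1 := by field_simp
    linarith
  have hlogc : 1 / ((M : ℝ) * c) ≤ Real.log c := by
    have h := Real.one_sub_inv_le_log_of_pos hcpos
    have : 1 / ((M : ℝ) * c) = 1 - c⁻¹ := by
      have h2 : c - 1 = 1 / (M : ℝ) := by rw [hc]; ring
      have h3 : 1 - c⁻¹ = (c - 1) / c := by field_simp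
      rw [h3, h2]; field_simp
    linarith
  have hpos : ∀ i ∈ T, 0 < 1 + r i := fun i hi => by linarith [hr i hi]
  have hP : 0 < ∏ i ∈ T, (1 + r i) := Finset.prod_pos hpos
  rw [← Real.log_le_log_iff (mul_pos (by linarith) hP) (by positivity),
    Real.log_mul (by linarith) hP.ne', Real.log_prod (fun i hi => (hpos i hi).ne'), Real.log_pow]
  have h1 := key (2 - A) (by linarith)
  have h2 : ∑ i ∈ T, Real.log (1 + r i) ≤ ∑ i ∈ T, (Real.log c + (1 + r i - c) / c) :=
    Finset.sum_le_sum fun i hi => key _ (hpos i hi)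
  have h3 : ∑ i ∈ T, (Real.log c + (1 + r i - c) / c)
      = #T * Real.log c + (#T * (1 - c) + A) / c := by
    rw [Finset.sum_add_distrib, ← Finset.sum_div, hA]
    have : ∀ i ∈ T, 1 + r i - c = (1 - c) + r i := fun i _ => by ring
    rw [Finset.sum_congr rfl this, Finset.sum_add_distrib]
    simp
    ring
  have h4 : (2 - A - c) / c + (#T * (1 - c) + A) / c
      = (M - (#T + 1)) * (1 / ((M : ℝ) * c)) := by
    have h5 : 1 - c = - (1 / (M : ℝ)) := by rw [hc]; ring
    have h6 : 2 - A - c = 1 - A - 1 / (M : ℝ) := by rw [hc]; ring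
    rw [h5, h6]; field_simp; ring
  have h7 : (M - (#T + 1) : ℝ) * (1 / ((M : ℝ) * c)) ≤ (M - (#T + 1)) * Real.log c := by
    apply mul_le_mul_of_nonneg_left hlogc
    have : ((#T + 1 : ℕ) : ℝ) ≤ M := by exact_mod_cast hM
    push_cast at this
    linarith
  linarith

theorem stmt_5 (n s : ℕ) (p : ℕ → ℝ) (b : ℝ)
    (hn : 1 ≤ n)
    (hp : ∀ i ∈ Finset.Icc 1 n, 0 < p i ∧ p i < 1)
    (hR1 : 1 ≤ oddsSum p n 1)
    (hs : IsOptimalThreshold p n s)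
    (hble : ∀ i ∈ Finset.Icc s n, b ≤ p i)
    (hbmem : ∃ i ∈ Finset.Icc s n, p i = b) :
    failProd p n s * oddsSum p n s
      ≥ (1 - 1 / (⌈1 / b⌉₊ : ℝ)) ^ (⌈1 / b⌉₊ - 1) ∧
    (1 - 1 / (⌈1 / b⌉₊ : ℝ)) ^ (⌈1 / b⌉₊ - 1) > 1 / Real.exp 1 := by
  unfold IsOptimalThreshold at hs
  rw [if_pos hR1] at hs
  obtain ⟨hsn, hRs, hmax⟩ := hs
  rw [Finset.mem_Icc] at hsn
  have hp' : ∀ i ∈ Finset.Icc s n, 0 < p i ∧ p i < 1 := fun i hi =>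
    hp i (by rw [Finset.mem_Icc] at *; omega)
  obtain ⟨j, hj, hjb⟩ := hbmem
  have hb0 : 0 < b := hjb ▸ (hp' j hj).1
  have hb1 : b < 1 := hjb ▸ (hp' j hj).2
  have hm2 : 1 < ⌈1 / b⌉₊ := by
    rw [Nat.lt_ceil, lt_div_iff₀ hb0]; simpa using hb1
  have hmb : 1 / b ≤ (⌈1 / b⌉₊ : ℝ) := Nat.le_ceil _
  obtain ⟨M, hM⟩ : ∃ M, ⌈1 / b⌉₊ = M + 1 := ⟨⌈1 / b⌉₊ - 1, by omega⟩
  rw [hM] at hm2 hmb ⊢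
  have hM0 : 0 < M := by omega
  have hMpos : (0 : ℝ) < M := by exact_mod_cast hM0
  push_cast at hmb ⊢
  rw [div_le_iff₀ hb0] at hmb
  have hbase : (1 - 1 / ((M : ℝ) + 1)) ^ M = 1 / (1 + 1 / (M : ℝ)) ^ M := by
    rw [← one_div_pow]
    congr 1
    field_simp
    ring
  rw [hbase]
  refine ⟨?_, ?_⟩
  · have hsplit : Finset.Icc s n = insert s (Finset.Icc (s + 1) n) := by
      ext i; simp only [Finset.mem_insert, Finset.mem_Icc]; omega
    have hnot : s ∉ Finset.Icc (s + 1) n := by simp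
    set T := Finset.Icc (s + 1) n with hT
    have hTs : ∀ i ∈ T, i ∈ Finset.Icc s n := fun i hi => by
      rw [hsplit]; exact Finset.mem_insert_of_mem hi
    set A := oddsSum p n (s + 1) with hA
    have hA' : A = ∑ i ∈ T, p i / (1 - p i) := rfl
    have hA1 : A < 1 := by
      rcases Nat.lt_or_ge s n with h | h
      · exact hmax (s + 1) (by rw [Finset.mem_Icc]; omega) (by omega)
      · have : T = ∅ := by rw [hT]; exact Finset.Icc_eq_empty (by omega)
        rw [hA', this]; simp
    have hrM : ∀ i ∈ T, 1 / (M : ℝ) ≤ p i / (1 - p i) := by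
      intro i hi
      have h1 := (hp' i (hTs i hi)).2
      have h2 := hble i (hTs i hi)
      rw [div_le_div_iff₀ hMpos (by linarith)]
      nlinarith
    have hcard : #T + 1 ≤ M := by
      have h := Finset.card_nsmul_le_sum T _ _ hrM
      rw [← hA', nsmul_eq_mul] at h
      have h2 : (#T : ℝ) * (1 / M) < 1 := lt_of_le_of_lt h hA1
      rw [mul_one_div, div_lt_one hMpos] at h2
      exact_mod_cast h2
    have hmain := aux_prod T (fun i => p i / (1 - p i))
      (fun i hi => le_trans (by positivity) (hrM i hi)) A hA' hA1 M hcard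
    have hprod : (∏ i ∈ T, (1 + p i / (1 - p i))) * (∏ i ∈ T, (1 - p i)) = 1 := by
      rw [← Finset.prod_mul_distrib]
      apply Finset.prod_eq_one
      intro i hi
      have h1 := (hp' i (hTs i hi)).2
      have : 1 - p i ≠ 0 := by linarith
      field_simp
      ring
    have hQ : 0 < ∏ i ∈ T, (1 - p i) := Finset.prod_pos fun i hi => by
      linarith [(hp' i (hTs i hi)).2]
    have hRe : oddsSum p n s = p s / (1 - p s) + A := by
      rw [hA', oddsSum, hsplit, Finset.sum_insert hnot]
    have hQe : failProd p n s = (1 - p s) * ∏ i ∈ T, (1 - p i) := by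
      rw [failProd, hsplit, Finset.prod_insert hnot]
    have hps := hp' s (by rw [Finset.mem_Icc]; omega)
    rw [hRe] at hRs
    rw [hRe, hQe]
    set Q := ∏ i ∈ T, (1 - p i)
    set P := ∏ i ∈ T, (1 + p i / (1 - p i))
    have hq : 0 < 1 - p s := by linarith
    have e1 : (1 - p s) * Q * (p s / (1 - p s) + A) = Q * (p s + (1 - p s) * A) := by
      field_simp
    have hRs' : 1 - p s ≤ p s + (1 - p s) * A := by
      have := mul_le_mul_of_nonneg_left hRs hq.le
      have e : (1 - p s) * (p s / (1 - p s) + A) = p s + (1 - p s) * A := by field_simp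
      linarith
    rw [e1, ge_iff_le, div_le_iff₀ (by positivity)]
    have hk : 1 ≤ (p s + (1 - p s) * A) * (2 - A) := by nlinarith
    have hpo : 0 ≤ p s + (1 - p s) * A := by linarith
    calc (1 : ℝ) ≤ (p s + (1 - p s) * A) * (2 - A) := hk
      _ = (Q * (p s + (1 - p s) * A)) * ((2 - A) * P) := by
        linear_combination (-(p s + (1 - p s) * A) * (2 - A)) * hprod
      _ ≤ _ := mul_le_mul_of_nonneg_left hmain (mul_nonneg hQ.le hpo)
  · apply one_div_lt_one_div_of_lt (by positivity)
    have h : 1 + 1 / (M : ℝ) < Real.exp (1 / M) := by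
      have := Real.add_one_lt_exp (x := 1 / (M : ℝ)) (by positivity)
      linarith
    calc (1 + 1 / (M : ℝ)) ^ M < (Real.exp (1 / M)) ^ M :=
          pow_lt_pow_left₀ h (by positivity) hM0.ne'
      _ = Real.exp 1 := by
        rw [← Real.exp_nat_mul]; congr 1; field_simp
end

section
/- Let p₁,…,pₙ ∈ (0,1) with R₁ = ∑_{i=1}^{n} pᵢ/(1−pᵢ) ≥ 1. Then the optimal win probability satisfies V(p₁,…,pₙ) > 1/e. -/
open Finset

theorem stmt_6 (n s : ℕ) (p : ℕ → ℝ)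
    (hn : 1 ≤ n)
    (hp : ∀ i ∈ Finset.Icc 1 n, 0 < p i ∧ p i < 1)
    (hR1 : 1 ≤ oddsSum p n 1)
    (hs : IsOptimalThreshold p n s) :
    failProd p n s * oddsSum p n s > 1 / Real.exp 1 := by
  unfold IsOptimalThreshold at hs
  rw [if_pos hR1] at hs
  obtain ⟨hsm, hs1, hmax⟩ := hs
  obtain ⟨hs0, hsn⟩ := Finset.mem_Icc.mp hsm
  have hT : oddsSum p n (s + 1) < 1 := by
    rcases Nat.lt_or_ge s n with h | h
    · exact hmax (s + 1) (Finset.mem_Icc.mpr ⟨by omega, h⟩) (by omega)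
    · unfold oddsSum
      rw [Finset.Icc_eq_empty (by omega)]
      simp
  have hI : Finset.Icc s n = insert s (Finset.Icc (s + 1) n) := by
    ext x
    simp only [Finset.mem_Icc, Finset.mem_insert]
    omega
  have hnot : s ∉ Finset.Icc (s + 1) n := by simp
  have hRs : oddsSum p n s = p s / (1 - p s) + oddsSum p n (s + 1) := by
    unfold oddsSum
    rw [hI, Finset.sum_insert hnot]
  have hQs : failProd p n s = (1 - p s) * failProd p n (s + 1) := by
    unfold failProd
    rw [hI, Finset.prod_insert hnot]
  have hQ : Real.exp (-oddsSum p n (s + 1)) ≤ failProd p n (s + 1) := by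
    unfold oddsSum failProd
    rw [← Finset.sum_neg_distrib, Real.exp_sum]
    apply Finset.prod_le_prod
    · intro i _
      exact (Real.exp_pos _).le
    · intro i hi
      have hi' := Finset.mem_Icc.mp hi
      obtain ⟨h0, h1⟩ := hp i (Finset.mem_Icc.mpr ⟨by omega, hi'.2⟩)
      have hq : 0 < 1 - p i := by linarith
      have h2 := Real.add_one_le_exp (p i / (1 - p i))
      have h3 : p i / (1 - p i) + 1 = (1 - p i)⁻¹ := by field_simp; ring
      rw [Real.exp_neg]
      rw [h3] at h2
      exact inv_le_of_inv_le₀ hq h2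
  obtain ⟨h0, h1⟩ := hp s hsm
  rw [hRs] at hs1
  rw [hRs, hQs]
  set T := oddsSum p n (s + 1)
  have hq : 0 < 1 - p s := by linarith
  have hexp := Real.add_one_lt_exp (x := 1 - T) (by linarith)
  have hc : (1 - p s) * (p s / (1 - p s) + T) = p s + (1 - p s) * T := by field_simp
  have hc1 : 1 - p s ≤ p s + (1 - p s) * T := by
    rw [← hc]
    nlinarith
  have hc2 : 1 ≤ (p s + (1 - p s) * T) * (2 - T) := by
    nlinarith
  have hcpos : 0 < p s + (1 - p s) * T := by linarith
  have hmain : 1 < (p s + (1 - p s) * T) * Real.exp (1 - T) := by nlinarith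
  have h4 : (1 - p s) * failProd p n (s + 1) * (p s / (1 - p s) + T)
      = (p s + (1 - p s) * T) * failProd p n (s + 1) := by rw [← hc]; ring
  rw [h4, gt_iff_lt, div_lt_iff₀ (Real.exp_pos 1)]
  have h5 : Real.exp (1 - T) = Real.exp (-T) * Real.exp 1 := by
    rw [← Real.exp_add]; congr 1; ring
  rw [h5] at hmain
  calc (1:ℝ) < (p s + (1 - p s) * T) * (Real.exp (-T) * Real.exp 1) := hmain
    _ ≤ (p s + (1 - p s) * T) * (failProd p n (s + 1) * Real.exp 1) := by gcongr
    _ = _ := by ring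
end

section
/- Let p ∈ (0,1) and let n be a natural number with n ≥ ⌈1/p⌉ − 1. Consider the Last-Success-Problem with pᵢ = p for all i = 1,…,n. Then the optimal threshold equals s = n − ⌈1/p⌉ + 2, and the optimal win probability equals V(p,…,p) = p·(⌈1/p⌉ − 1)·(1−p)^{⌈1/p⌉ − 2}. -/
open Finset

theorem stmt_7 (n : ℕ) (p : ℝ)
    (hp0 : 0 < p) (hp1 : p < 1)
    (hn : 1 ≤ n) (hnp : n ≥ ⌈1 / p⌉₊ - 1) :
    IsOptimalThreshold (fun _ => p) n (n + 2 - ⌈1 / p⌉₊) ∧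
    failProd (fun _ => p) n (n + 2 - ⌈1 / p⌉₊) *
        oddsSum (fun _ => p) n (n + 2 - ⌈1 / p⌉₊)
      = p * ((⌈1 / p⌉₊ : ℝ) - 1) * (1 - p) ^ (⌈1 / p⌉₊ - 2) := by 
  have hq : 0 < 1 - p := by linarith
  have hlt : (1:ℝ) < 1 / p := by rw [lt_div_iff₀ hp0]; linarith
  have hm2 : 1 < ⌈1 / p⌉₊ := Nat.lt_ceil.mpr (by exact_mod_cast hlt)
  have hub : 1 / p ≤ (⌈1 / p⌉₊ : ℝ) := Nat.le_ceil _
  have hlb : (⌈1 / p⌉₊ : ℝ) < 1 / p + 1 := Nat.ceil_lt_add_one (by positivity)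
  generalize ⌈1 / p⌉₊ = m at *
  obtain ⟨j, rfl⟩ : ∃ j, m = j + 2 := ⟨m - 2, by omega⟩
  obtain ⟨t, rfl⟩ : ∃ t, n = j + 1 + t := ⟨n - (j + 1), by omega⟩
  have hs : j + 1 + t + 2 - (j + 2) = t + 1 := by omega
  have hj : j + 2 - 2 = j := by omega
  rw [hs, hj]
  push_cast at hub hlb ⊢
  rw [div_le_iff₀ hp0] at hub
  have hlb' : ((j:ℝ) + 1) * p < 1 := by
    rw [← lt_div_iff₀ hp0]; linarith
  have hc : j + 1 + t + 1 - (t + 1) = j + 1 := by omega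
  have hsum : ∀ k, oddsSum (fun _ => p) (j + 1 + t) k
      = ((j + 1 + t + 1 - k : ℕ) : ℝ) * p / (1 - p) := by
    intro k
    simp [oddsSum, mul_div_assoc]
  have hprod : failProd (fun _ => p) (j + 1 + t) (t + 1) = (1 - p) ^ (j + 1) := by
    simp [failProd, hc]
  refine ⟨?_, ?_⟩
  · have hR : ∀ k, k ≤ t + 1 → 1 ≤ oddsSum (fun _ => p) (j + 1 + t) k := by
      intro k hk
      rw [hsum, le_div_iff₀ hq]
      have h : ((j + 1 : ℕ) : ℝ) ≤ ((j + 1 + t + 1 - k : ℕ) : ℝ) := by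
        exact_mod_cast (by omega)
      push_cast [-Nat.cast_sub] at h
      have := mul_le_mul_of_nonneg_right h hp0.le
      linarith
    unfold IsOptimalThreshold
    rw [if_pos (hR 1 (by omega))]
    refine ⟨Finset.mem_Icc.mpr ⟨by omega, by omega⟩, hR _ le_rfl, ?_⟩
    intro k _ hk
    rw [hsum, div_lt_iff₀ hq]
    have h : ((j + 1 + t + 1 - k : ℕ) : ℝ) ≤ (j : ℝ) := by
      exact_mod_cast (by omega)
    have := mul_le_mul_of_nonneg_right h hp0.le
    linarith
  · rw [hsum, hprod, hc, pow_succ]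
    push_cast
    field_simp
    ring
end

section
/- Let p ∈ (0,1) and let n ≥ 1 be a natural number with n < ⌈1/p⌉ − 1. Consider the Last-Success-Problem with pᵢ = p for all i = 1,…,n. Then R₁ < 1, the optimal threshold equals s = 1, and the optimal win probability equals V(p,…,p) = n·p·(1−p)^{n−1}. -/
open Finset

theorem stmt_8 (n : ℕ) (p : ℝ)
    (hp0 : 0 < p) (hp1 : p < 1)
    (hn : 1 ≤ n) (hnp : n < ⌈1 / p⌉₊ - 1) :
    oddsSum (fun _ => p) n 1 < 1 ∧
    IsOptimalThreshold (fun _ => p) n 1 ∧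
    failProd (fun _ => p) n 1 * oddsSum (fun _ => p) n 1
      = (n : ℝ) * p * (1 - p) ^ (n - 1) := by 
  have h1 : n + 1 < ⌈1 / p⌉₊ := by omega
  have h2 : ((n + 1 : ℕ) : ℝ) < 1 / p := Nat.lt_ceil.mp h1
  have h3 : ((n : ℝ) + 1) * p < 1 := by
    rw [lt_div_iff₀ hp0] at h2
    push_cast at h2
    exact h2
  have hq : 0 < 1 - p := by linarith
  have hR : oddsSum (fun _ => p) n 1 = n * (p / (1 - p)) := by
    simp [oddsSum]
  have hQ : failProd (fun _ => p) n 1 = (1 - p) ^ n := by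
    simp [failProd]
  have hlt : oddsSum (fun _ => p) n 1 < 1 := by
    rw [hR, ← mul_div_assoc, div_lt_one hq]
    linarith
  refine ⟨hlt, ?_, ?_⟩
  · unfold IsOptimalThreshold
    rw [if_neg (not_le.mpr hlt)]
  · rw [hR, hQ]
    obtain ⟨m, rfl⟩ : ∃ m, n = m + 1 := ⟨n - 1, by omega⟩
    rw [Nat.add_sub_cancel, pow_succ]
    field_simp
end

section
/- Let n ≥ 1 and p₁,…,pₙ ∈ (0,1) with R₁ = ∑_{i=1}^{n} pᵢ/(1−pᵢ) < 1. Then the optimal win probability satisfies V(p₁,…,pₙ) = R₁·∏_{i=1}^{n}(1−pᵢ) ≥ R₁·(n/(n+R₁))^n > R₁·e^{−R₁}. -/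
open Finset

theorem stmt_9 (n s : ℕ) (p : ℕ → ℝ)
    (hn : 1 ≤ n)
    (hp : ∀ i ∈ Finset.Icc 1 n, 0 < p i ∧ p i < 1)
    (hR1 : oddsSum p n 1 < 1)
    (hs : IsOptimalThreshold p n s) :
    failProd p n s * oddsSum p n s
      = oddsSum p n 1 * ∏ i ∈ Finset.Icc 1 n, (1 - p i) ∧
    oddsSum p n 1 * ∏ i ∈ Finset.Icc 1 n, (1 - p i)
      ≥ oddsSum p n 1 * ((n : ℝ) / (n + oddsSum p n 1)) ^ n ∧
    oddsSum p n 1 * ((n : ℝ) / (n + oddsSum p n 1)) ^ n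
      > oddsSum p n 1 * Real.exp (-(oddsSum p n 1)) := by
  have h0 : ¬ (1 ≤ oddsSum p n 1) := not_le.mpr hR1
  unfold IsOptimalThreshold at hs
  rw [if_neg h0] at hs
  subst hs
  have hRpos : 0 < oddsSum p n 1 := by
    unfold oddsSum
    apply Finset.sum_pos
    · intro i hi
      have := hp i hi
      exact div_pos this.1 (by linarith [this.2])
    · exact ⟨1, by simp [hn]⟩
  have hnpos : (0 : ℝ) < n := by exact_mod_cast hn
  have hsum : ∑ i ∈ Finset.Icc 1 n, 1 / (1 - p i) = n + oddsSum p n 1 := by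
    have h1 : ∀ i ∈ Finset.Icc 1 n, 1 / (1 - p i) = 1 + p i / (1 - p i) := by
      intro i hi
      have h2 : 1 - p i ≠ 0 := by
        have : 0 < 1 - p i := by linarith [(hp i hi).2]
        exact this.ne'
      field_simp
      ring
    rw [Finset.sum_congr rfl h1, Finset.sum_add_distrib]
    simp [oddsSum]
  have hPpos : 0 < ∏ i ∈ Finset.Icc 1 n, (1 - p i) :=
    Finset.prod_pos fun i hi => by linarith [(hp i hi).2]
  refine ⟨by unfold failProd; ring, ?_, ?_⟩
  · apply mul_le_mul_of_nonneg_left _ hRpos.le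
    set R := oddsSum p n 1 with hR
    set x : ℝ := n / (n + R) with hx
    have hxpos : 0 < x := by positivity
    have h1 : ∏ i ∈ Finset.Icc 1 n, (x * (1 / (1 - p i)))
        ≤ ∏ i ∈ Finset.Icc 1 n, Real.exp (x * (1 / (1 - p i)) - 1) := by
      apply Finset.prod_le_prod
      · intro i hi
        have : 0 < 1 - p i := by linarith [(hp i hi).2]
        positivity
      · intro i hi
        linarith [Real.add_one_le_exp (x * (1 / (1 - p i)) - 1)]
    rw [← Real.exp_sum, Finset.sum_sub_distrib, ← Finset.mul_sum, hsum,
      Finset.prod_mul_distrib] at h1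
    have h2 : x * (n + R) = n := by rw [hx]; field_simp
    rw [h2] at h1
    simp only [Finset.prod_const, Finset.prod_div_distrib, Finset.sum_const, Nat.card_Icc,
      Nat.add_sub_cancel, one_pow, nsmul_eq_mul, mul_one, sub_self, Real.exp_zero] at h1
    rw [mul_one_div, div_le_one hPpos] at h1
    exact h1
  · apply mul_lt_mul_of_pos_left _ hRpos
    set R := oddsSum p n 1 with hR
    have h1 : Real.exp (-R) = (Real.exp (-(R / n))) ^ n := by
      rw [← Real.exp_nat_mul]
      congr 1
      field_simp
    rw [h1]
    apply pow_lt_pow_left₀ _ (Real.exp_pos _).le (by omega)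
    have h2 : R / n + 1 < Real.exp (R / n) := Real.add_one_lt_exp (by positivity)
    have h3 : (n : ℝ) / (n + R) = (R / n + 1)⁻¹ := by
      field_simp
      ring
    rw [h3, Real.exp_neg]
    exact inv_strictAnti₀ (by positivity) h2
end

section
/- Let n ≥ 1 and let x₁,…,xₙ ∈ (0,1) be real numbers with R := ∑_{i=1}^{n} xᵢ/(1−xᵢ) < 1, and set Q := ∏_{i=1}^{n} (1−xᵢ). Then R·Q/(1−Q) ≥ R·(n/(n+R))^n/(1 − (n/(n+R))^n) > R/(e^R − 1) ≥ 1/(e − 1). -/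
theorem aux_inv (R P : ℝ) (hP : 1 < P) : R * P⁻¹ / (1 - P⁻¹) = R / (P - 1) := by
  have h1 : P ≠ 0 := by positivity
  have h2 : P - 1 ≠ 0 := by linarith
  have h3 : 1 - P⁻¹ = (P - 1) / P := by field_simp
  rw [h3]
  field_simp

theorem stmt_10 (n : ℕ) (x : ℕ → ℝ) (R Q : ℝ)
    (hn : 1 ≤ n)
    (hx : ∀ i ∈ Finset.Icc 1 n, 0 < x i ∧ x i < 1)
    (hR : R = ∑ i ∈ Finset.Icc 1 n, x i / (1 - x i))
    (hR1 : R < 1)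
    (hQ : Q = ∏ i ∈ Finset.Icc 1 n, (1 - x i)) :
    R * Q / (1 - Q)
      ≥ R * ((n : ℝ) / (n + R)) ^ n / (1 - ((n : ℝ) / (n + R)) ^ n) ∧
    R * ((n : ℝ) / (n + R)) ^ n / (1 - ((n : ℝ) / (n + R)) ^ n)
      > R / (Real.exp R - 1) ∧
    R / (Real.exp R - 1) ≥ 1 / (Real.exp 1 - 1) := by
  have hne : (Finset.Icc 1 n).Nonempty := ⟨1, by simp [hn]⟩
  have hn0 : n ≠ 0 := by omega
  have hnpos : (0 : ℝ) < n := by exact_mod_cast hn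
  have hRpos : 0 < R := by
    rw [hR]
    refine Finset.sum_pos (fun i hi => ?_) hne
    exact div_pos (hx i hi).1 (by linarith [(hx i hi).2])
  have hQpos : 0 < Q := by
    rw [hQ]
    exact Finset.prod_pos (fun i hi => by linarith [(hx i hi).2])
  have hQ1 : Q < 1 := by
    have h := Finset.prod_lt_prod_of_nonempty (s := Finset.Icc 1 n) (f := fun i => 1 - x i)
      (g := fun _ => (1 : ℝ)) (fun i hi => by linarith [(hx i hi).2])
      (fun i hi => by linarith [(hx i hi).1]) hne
    rw [Finset.prod_const_one] at h
    rwa [hQ]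
  have hP1 : 1 < Q⁻¹ := (one_lt_inv₀ hQpos).2 hQ1
  have hA1 : 1 < (1 + R / n) ^ n := one_lt_pow₀ (by linarith [div_pos hRpos hnpos]) hn0
  have hAeq : ((n : ℝ) / (n + R)) ^ n = ((1 + R / n) ^ n)⁻¹ := by
    rw [← inv_pow]
    congr 1
    have : (n : ℝ) + R ≠ 0 := by positivity
    field_simp
  have hPA : Q⁻¹ ≤ (1 + R / n) ^ n := by
    have h := Real.geom_mean_le_arith_mean (Finset.Icc 1 n) (fun _ => (1 : ℝ))
      (fun i => (1 - x i)⁻¹) (fun i _ => zero_le_one) (by simpa using Nat.pos_of_ne_zero hn0)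
      (fun i hi => inv_nonneg.2 (by linarith [(hx i hi).2]))
    have hs : ∑ i ∈ Finset.Icc 1 n, (1 - x i)⁻¹ = n + R := by
      have : ∀ i ∈ Finset.Icc 1 n, (1 - x i)⁻¹ = 1 + x i / (1 - x i) := by
        intro i hi
        have : 1 - x i ≠ 0 := by linarith [(hx i hi).2]
        field_simp
        ring
      rw [Finset.sum_congr rfl this, Finset.sum_add_distrib, ← hR]
      simp
    simp only [Real.rpow_one, one_mul, Finset.prod_inv_distrib, ← hQ, hs, Finset.sum_const,
      Nat.card_Icc, Nat.add_sub_cancel, nsmul_eq_mul, mul_one] at h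
    have h2 := pow_le_pow_left₀ (by positivity) h n
    rw [Real.rpow_inv_natCast_pow (by positivity) hn0] at h2
    have h3 : ((n : ℝ) + R) / n = 1 + R / n := by field_simp
    rwa [h3] at h2
  have hAe : (1 + R / n) ^ n < Real.exp R := by
    have h1 := Real.add_one_lt_exp (x := R / n) (by positivity)
    have h2 := pow_lt_pow_left₀ (by linarith : 1 + R / n < Real.exp (R / n))
      (by positivity) hn0
    rwa [← Real.exp_nat_mul, mul_div_cancel₀ _ hnpos.ne'] at h2
  have hconv : Real.exp R - 1 ≤ R * (Real.exp 1 - 1) := by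
    have h := convexOn_exp.2 (Set.mem_univ 0) (Set.mem_univ 1)
      (by linarith : 0 ≤ 1 - R) hRpos.le (by ring)
    simp at h
    linarith
  rw [hAeq, aux_inv R _ hA1]
  refine ⟨?_, ?_, ?_⟩
  · have := aux_inv R _ hP1
    rw [inv_inv] at this
    rw [this]
    exact div_le_div_of_nonneg_left hRpos.le (by linarith) (by linarith)
  · exact div_lt_div_of_pos_left hRpos (by linarith) (by linarith)
  · have he : 0 < Real.exp R - 1 := by linarith
    have he1 : 0 < Real.exp 1 - 1 := by linarith [Real.add_one_lt_exp (x := 1) one_ne_zero]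
    rw [ge_iff_le, div_le_div_iff₀ he1 he]
    linarith
end

section
/- Let p₁,…,pₙ ∈ (0,1), let s be the optimal threshold, V = Q_s·R_s the optimal win probability, and Q₁ = ∏_{i=1}^{n}(1−pᵢ). Then max(Q₁, V) > 1/e. -/
open Finset

lemma aux_failProd (n k : ℕ) (p : ℕ → ℝ) (hk : 1 ≤ k)
    (hp : ∀ i ∈ Finset.Icc 1 n, 0 < p i ∧ p i < 1) :
    Real.exp (-oddsSum p n k) ≤ failProd p n k := by
  unfold oddsSum failProd
  rw [← Finset.sum_neg_distrib, Real.exp_sum]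
  apply Finset.prod_le_prod
  · intro i _
    exact (Real.exp_pos _).le
  · intro i hi
    rw [Finset.mem_Icc] at hi
    obtain ⟨h0, h1⟩ := hp i (Finset.mem_Icc.2 ⟨by omega, hi.2⟩)
    have h2 : 0 < 1 - p i := by linarith
    have h3 := Real.add_one_le_exp (p i / (1 - p i))
    have h4 : p i / (1 - p i) + 1 = (1 - p i)⁻¹ := by
      field_simp
      ring
    rw [h4] at h3
    rw [Real.exp_neg]
    exact inv_le_of_inv_le₀ h2 h3

theorem stmt_11 (n s : ℕ) (p : ℕ → ℝ)
    (hn : 1 ≤ n)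
    (hp : ∀ i ∈ Finset.Icc 1 n, 0 < p i ∧ p i < 1)
    (hs : IsOptimalThreshold p n s) :
    max (failProd p n 1) (failProd p n s * oddsSum p n s) > 1 / Real.exp 1 := by
  have he : 1 / Real.exp 1 = Real.exp (-1) := by rw [Real.exp_neg, one_div]
  rw [he, gt_iff_lt]
  unfold IsOptimalThreshold at hs
  split_ifs at hs with h
  · obtain ⟨hs1, hs2, hs3⟩ := hs
    apply lt_max_of_lt_right
    have hm := Finset.mem_Icc.1 hs1
    have hQ := aux_failProd n (s + 1) p (by omega) hp
    have ht : oddsSum p n (s + 1) < 1 := by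
      by_cases hsn : s + 1 ≤ n
      · exact hs3 _ (Finset.mem_Icc.2 ⟨by omega, hsn⟩) (by omega)
      · unfold oddsSum
        rw [Finset.Icc_eq_empty hsn]
        simp
    have hI : Finset.Icc s n = insert s (Finset.Icc (s + 1) n) := by
      ext i
      simp only [Finset.mem_Icc, Finset.mem_insert]
      omega
    have hR : oddsSum p n s = p s / (1 - p s) + oddsSum p n (s + 1) := by
      unfold oddsSum
      rw [hI, Finset.sum_insert (by simp)]
    have hF : failProd p n s = (1 - p s) * failProd p n (s + 1) := by
      unfold failProd
      rw [hI, Finset.prod_insert (by simp)]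
    obtain ⟨h0, h1⟩ := hp s hs1
    rw [hR] at hs2
    rw [hR, hF]
    generalize oddsSum p n (s + 1) = t at *
    generalize failProd p n (s + 1) = Q at *
    generalize p s = q at *
    have h2 : 0 < 1 - q := by linarith
    have h3 : (1 - q) * Q * (q / (1 - q) + t) = Q * (q + (1 - q) * t) := by
      field_simp
    rw [h3]
    have h5 : 1 - q ≤ q + (1 - q) * t := by
      have := mul_le_mul_of_nonneg_left hs2 h2.le
      have h6 : (1 - q) * (q / (1 - q) + t) = q + (1 - q) * t := by field_simp
      linarith
    have h7 : 1 ≤ (q + (1 - q) * t) * (2 - t) := by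
      nlinarith [mul_nonneg (sub_nonneg.2 ht.le) (sub_nonneg.2 h5)]
    have h8 : (1 - t) + 1 < Real.exp (1 - t) := Real.add_one_lt_exp (by linarith)
    have h9 : Real.exp (-1) * Real.exp (1 - t) = Real.exp (-t) := by
      rw [← Real.exp_add]
      ring_nf
    have hpos : 0 < q + (1 - q) * t := by linarith
    have he1 := Real.exp_pos (-1)
    calc Real.exp (-1) ≤ Real.exp (-1) * ((q + (1 - q) * t) * (2 - t)) :=
          le_mul_of_one_le_right he1.le h7
      _ = (Real.exp (-1) * (2 - t)) * (q + (1 - q) * t) := by ring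
      _ < (Real.exp (-1) * Real.exp (1 - t)) * (q + (1 - q) * t) := by
          apply mul_lt_mul_of_pos_right _ hpos
          apply mul_lt_mul_of_pos_left _ he1
          linarith
      _ ≤ Q * (q + (1 - q) * t) := by
          rw [h9]
          exact mul_le_mul_of_nonneg_right hQ hpos.le
  · apply lt_max_of_lt_left
    refine lt_of_lt_of_le ?_ (aux_failProd n 1 p le_rfl hp)
    apply Real.exp_lt_exp.2
    linarith [not_le.1 h]
end

section
/- Let p₁,…,pₙ ∈ (0,1) with R₁ = ∑_{i=1}^{n} pᵢ/(1−pᵢ) > 1, let s be the optimal threshold, and let Q₁ = ∏_{i=1}^{n}(1−pᵢ). Then the optimal win probability satisfies V(p₁,…,pₙ) = Q_s·R_s > Q₁; that is, when R₁ > 1 playing the standard game is strictly better than predicting that all trials are 0. -/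
open Finset

theorem stmt_12 (n s : ℕ) (p : ℕ → ℝ)
    (hn : 1 ≤ n)
    (hp : ∀ i ∈ Finset.Icc 1 n, 0 < p i ∧ p i < 1)
    (hR1 : 1 < oddsSum p n 1)
    (hs : IsOptimalThreshold p n s) :
    failProd p n s * oddsSum p n s > failProd p n 1 := by
  have h1 : 1 ≤ oddsSum p n 1 := hR1.le
  unfold IsOptimalThreshold at hs
  rw [if_pos h1] at hs
  obtain ⟨hs1, hs2, -⟩ := hs
  rw [Finset.mem_Icc] at hs1
  obtain ⟨ha, hb⟩ := hs1
  have hQ : 0 < failProd p n s := by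
    unfold failProd
    refine Finset.prod_pos fun i hi => ?_
    rw [Finset.mem_Icc] at hi
    have := (hp i (Finset.mem_Icc.2 ⟨by omega, hi.2⟩)).2
    linarith
  rcases Nat.eq_or_lt_of_le ha with h | h
  · subst h
    nlinarith
  · have hsplit : failProd p n 1 = (∏ i ∈ Finset.Ico 1 s, (1 - p i)) * failProd p n s := by
      unfold failProd
      have e : ∀ k, Finset.Icc k n = Finset.Ico k (n + 1) := by
        intro k
        ext x
        simp only [Finset.mem_Icc, Finset.mem_Ico]
        omega
      rw [e, e, Finset.prod_Ico_consecutive _ ha (by omega)]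
    have hlt : (∏ i ∈ Finset.Ico 1 s, (1 - p i)) < 1 := by
      have hb' : ∀ i ∈ Finset.Ico 1 s, 0 < p i ∧ p i < 1 := by
        intro i hi
        rw [Finset.mem_Ico] at hi
        exact hp i (Finset.mem_Icc.2 ⟨hi.1, by omega⟩)
      have := Finset.prod_lt_prod_of_nonempty (s := Finset.Ico 1 s) (f := fun i => 1 - p i)
        (g := fun _ => (1 : ℝ)) (fun i hi => by linarith [(hb' i hi).2])
        (fun i hi => by linarith [(hb' i hi).1]) (Finset.nonempty_Ico.2 h)
      simpa using this
    rw [hsplit]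
    nlinarith
end

section
/- Let p₁,…,pₙ ∈ (0,1), let s be the optimal threshold, V = Q_s·R_s the optimal win probability, and Q₁ = ∏_{i=1}^{n}(1−pᵢ). Then V ≤ max(Q₁, V) < V/(1 − Q₁). -/
open Finset

lemma aux_prod_s13 (p : ℕ → ℝ) (A : Finset ℕ) (h : ∀ i ∈ A, 0 < p i ∧ p i < 1) :
    0 < ∏ i ∈ A, (1 - p i) ∧ ∏ i ∈ A, (1 - p i) ≤ 1 ∧
      1 - ∑ i ∈ A, p i ≤ ∏ i ∈ A, (1 - p i) := by
  induction A using Finset.induction_on with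
  | empty => simp
  | insert a A ha ih =>
    obtain ⟨h1, h2, h3⟩ := ih (fun i hi => h i (Finset.mem_insert_of_mem hi))
    obtain ⟨h4, h5⟩ := h a (Finset.mem_insert_self a A)
    rw [Finset.prod_insert ha, Finset.sum_insert ha]
    refine ⟨mul_pos (by linarith) h1, ?_, ?_⟩ <;> nlinarith

theorem stmt_13 (n s : ℕ) (p : ℕ → ℝ)
    (hn : 1 ≤ n)
    (hp : ∀ i ∈ Finset.Icc 1 n, 0 < p i ∧ p i < 1)
    (hs : IsOptimalThreshold p n s) :
    failProd p n s * oddsSum p n s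
      ≤ max (failProd p n 1) (failProd p n s * oddsSum p n s) ∧
    max (failProd p n 1) (failProd p n s * oddsSum p n s)
      < failProd p n s * oddsSum p n s / (1 - failProd p n 1) := by
  refine ⟨le_max_right _ _, ?_⟩
  have hne : (Finset.Icc 1 n).Nonempty := ⟨1, by simp [hn]⟩
  obtain ⟨q0, q1, q2⟩ := aux_prod_s13 p (Finset.Icc 1 n) hp
  have hlt : ∀ i ∈ Finset.Icc 1 n, p i < p i / (1 - p i) := by
    intro i hi
    obtain ⟨h1, h2⟩ := hp i hi
    rw [lt_div_iff₀ (by linarith)]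
    nlinarith
  have hsum := Finset.sum_lt_sum_of_nonempty hne hlt
  have hpsum : 0 < ∑ i ∈ Finset.Icc 1 n, p i :=
    Finset.sum_pos (fun i hi => (hp i hi).1) hne
  have q3 : ∏ i ∈ Finset.Icc 1 n, (1 - p i) < 1 := by
    have h1 : (1 : ℕ) ∈ Finset.Icc 1 n := by simp [hn]
    rw [← Finset.mul_prod_erase _ _ h1]
    obtain ⟨e0, e1, _⟩ := aux_prod_s13 p ((Finset.Icc 1 n).erase 1)
      (fun i hi => hp i (Finset.mem_of_mem_erase hi))
    obtain ⟨h2, h3⟩ := hp 1 h1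
    nlinarith
  have key : 0 < failProd p n s * oddsSum p n s ∧
      failProd p n 1 * (1 - failProd p n 1) < failProd p n s * oddsSum p n s := by
    unfold IsOptimalThreshold at hs
    split_ifs at hs with hR
    · obtain ⟨hs1, hs2, _⟩ := hs
      have hsub : Finset.Icc s n ⊆ Finset.Icc 1 n :=
        Finset.Icc_subset_Icc_left (Finset.mem_Icc.1 hs1).1
      obtain ⟨t0, _, _⟩ := aux_prod_s13 p (Finset.Icc s n) (fun i hi => hp i (hsub hi))
      obtain ⟨u0, u1, _⟩ := aux_prod_s13 p (Finset.Icc 1 n \ Finset.Icc s n)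
        (fun i hi => hp i (Finset.mem_sdiff.1 hi).1)
      have hmul := Finset.prod_sdiff (f := fun i => 1 - p i) hsub
      have hle : failProd p n 1 ≤ failProd p n s := by
        unfold failProd
        rw [← hmul]
        nlinarith
      have t0' : 0 < failProd p n s := t0
      have q0' : 0 < failProd p n 1 := q0
      constructor
      · exact mul_pos t0' (by linarith)
      · nlinarith
    · subst hs
      have q0' : 0 < failProd p n 1 := q0
      have hR1 : 1 - failProd p n 1 < oddsSum p n 1 := by
        unfold failProd oddsSum
        linarith
      have hR0 : 0 < oddsSum p n 1 := by
        unfold oddsSum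
        linarith
      exact ⟨mul_pos q0' hR0, mul_lt_mul_of_pos_left hR1 q0'⟩
  obtain ⟨k1, k2⟩ := key
  have q0' : 0 < failProd p n 1 := q0
  have q3' : failProd p n 1 < 1 := q3
  rw [lt_div_iff₀ (by linarith)]
  rcases max_cases (failProd p n 1) (failProd p n s * oddsSum p n s) with ⟨h, _⟩ | ⟨h, _⟩ <;> rw [h]
  · exact k2
  · nlinarith
end

section
/- Let p₁,…,pₙ ∈ (0,1) and let s be the optimal threshold. Then the optimal win probability satisfies V(p₁,…,pₙ) = Q_s·R_s > R_s·e^{−R_s}. -/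
open Finset

theorem stmt_17 (n s : ℕ) (p : ℕ → ℝ)
    (hn : 1 ≤ n)
    (hp : ∀ i ∈ Finset.Icc 1 n, 0 < p i ∧ p i < 1)
    (hs : IsOptimalThreshold p n s) :
    failProd p n s * oddsSum p n s
      > oddsSum p n s * Real.exp (-(oddsSum p n s)) := by 
  have hs' : 1 ≤ s ∧ s ≤ n := by
    unfold IsOptimalThreshold at hs
    split_ifs at hs with h
    · exact Finset.mem_Icc.mp hs.1
    · subst hs
      exact ⟨le_refl _, hn⟩
  have hp' : ∀ i ∈ Finset.Icc s n, 0 < p i ∧ p i < 1 := by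
    intro i hi
    rw [Finset.mem_Icc] at hi
    exact hp i (Finset.mem_Icc.mpr ⟨hs'.1.trans hi.1, hi.2⟩)
  have hne : (Finset.Icc s n).Nonempty := Finset.nonempty_Icc.mpr hs'.2
  have hR : 0 < oddsSum p n s := by
    refine Finset.sum_pos (fun i hi => ?_) hne
    have h := hp' i hi
    exact div_pos h.1 (by linarith [h.2])
  have hQ : Real.exp (-(oddsSum p n s)) < failProd p n s := by
    unfold oddsSum failProd
    rw [← Finset.sum_neg_distrib, Real.exp_sum]
    refine Finset.prod_lt_prod_of_nonempty (fun i _ => Real.exp_pos _) (fun i hi => ?_) hne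
    have h := hp' i hi
    have h1 : 0 < 1 - p i := by linarith [h.2]
    have h2 : 0 < p i / (1 - p i) := div_pos h.1 h1
    have h3 := Real.add_one_lt_exp h2.ne'
    have h4 : p i / (1 - p i) + 1 = (1 - p i)⁻¹ := by
      field_simp
      ring
    rw [h4] at h3
    rw [Real.exp_neg]
    exact inv_lt_of_inv_lt₀ h1 h3
  rw [gt_iff_lt, mul_comm (failProd p n s)]
  exact mul_lt_mul_of_pos_left hQ hR
end
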